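/- Let L_t be a time-dependent GKSL generator with Hermitian jump operators satisfying Condition Q. Suppose there exists t0 ≥ 0 such that t ↦ H_t and t ↦ L_{m,t} are infinitely differentiable on a neighborhood of t0 and the algebra A^ad_{t0} equals the full matrix algebra of d×d complex matrices. Then for every density matrix ρ0, every solution ρ_t with ρ_0 = ρ0 satisfies lim_{t→∞} ρ_t = I/d. -/

import Mathlib

open Matrix Filter
open scoped ComplexOrder

attribute [local instance] Matrix.normedAddCommGroup Matrix.normedSpace

noncomputable def hsNorm {d : ℕ} (A : Matrix (Fin d) (Fin d) ℂ) : ℝ :=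
  Real.sqrt ((Matrix.trace (Aᴴ * A)).re)

noncomputable def opNorm2 {d : ℕ}
    (Φ : Matrix (Fin d) (Fin d) ℂ → Matrix (Fin d) (Fin d) ℂ) : ℝ :=
  sSup {r : ℝ | ∃ A, hsNorm A = 1 ∧ r = hsNorm (Φ A)}

noncomputable def gksl {d M : ℕ} (H : ℝ → Matrix (Fin d) (Fin d) ℂ)
    (L : Fin M → ℝ → Matrix (Fin d) (Fin d) ℂ) (t : ℝ)
    (ρ : Matrix (Fin d) (Fin d) ℂ) : Matrix (Fin d) (Fin d) ℂ :=
  (-Complex.I) • (H t * ρ - ρ * H t) +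
    ∑ m : Fin M, (L m t * ρ * L m t - (2⁻¹ : ℂ) • ((L m t) ^ 2 * ρ + ρ * (L m t) ^ 2))

def CondQ {d : ℕ}
    (ℒ : ℝ → Matrix (Fin d) (Fin d) ℂ → Matrix (Fin d) (Fin d) ℂ) : Prop :=
  (∀ t0 : ℝ, 0 ≤ t0 → ∀ ε > (0 : ℝ), ∃ δ > (0 : ℝ), ∀ t : ℝ, 0 ≤ t → |t - t0| < δ →
      opNorm2 (fun A => ℒ t A - ℒ t0 A) < ε) ∧
  (∃ M > (0 : ℝ), ∀ t : ℝ, 0 ≤ t → opNorm2 (ℒ t) ≤ M) ∧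
  (∀ ε > (0 : ℝ), ∀ δ > (0 : ℝ), ∀ t0 : ℝ, 0 ≤ t0 →
    ∃ ts : ℕ → ℝ, (∀ n, 0 ≤ ts n) ∧ (∀ n, ts n + δ < ts (n + 1)) ∧
      ∀ n, ∀ t ∈ Set.Icc (0 : ℝ) δ,
        opNorm2 (fun A => ℒ (ts n + t) A - ℒ (t0 + t) A) < ε)

def IsDensity {d : ℕ} (ρ : Matrix (Fin d) (Fin d) ℂ) : Prop :=
  ρ.PosSemidef ∧ Matrix.trace ρ = 1


noncomputable def hsNormSq {d : ℕ} (A : Matrix (Fin d) (Fin d) ℂ) : ℝ :=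
  (Matrix.trace (Aᴴ * A)).re

noncomputable def opNorm2' {d : ℕ}
    (Φ : Matrix (Fin d) (Fin d) ℂ → Matrix (Fin d) (Fin d) ℂ) : ℝ :=
  sSup {r : ℝ | ∃ A, hsNorm A = 1 ∧ Matrix.trace A = 0 ∧ r = hsNorm (Φ A)}

/-- The adjoint operation on a time-dependent family of matrices:
`ad(A)_t = i[H_t, A_t] + ∂_t A_t`. -/
noncomputable def adOp {d : ℕ} (H : ℝ → Matrix (Fin d) (Fin d) ℂ)
    (A : ℝ → Matrix (Fin d) (Fin d) ℂ) : ℝ → Matrix (Fin d) (Fin d) ℂ :=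
  fun t => Complex.I • (H t * A t - A t * H t) + deriv A t

/-- `n`-fold application of the adjoint operation to a family of matrices. -/
noncomputable def adPow {d : ℕ} (H : ℝ → Matrix (Fin d) (Fin d) ℂ) :
    ℕ → (ℝ → Matrix (Fin d) (Fin d) ℂ) → (ℝ → Matrix (Fin d) (Fin d) ℂ)
  | 0, A => A
  | n + 1, A => adOp H (adPow H n A)



theorem hsNormSq_eq_sum {d : ℕ} (A : Matrix (Fin d) (Fin d) ℂ) :
    hsNormSq A = ∑ i, ∑ j, ‖A i j‖ ^ 2 := by
  unfold hsNormSq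
  simp only [Matrix.trace, Matrix.diag, Matrix.mul_apply, Matrix.conjTranspose_apply,
    Complex.re_sum]
  rw [Finset.sum_comm]
  refine Finset.sum_congr rfl fun i _ => Finset.sum_congr rfl fun j _ => ?_
  rw [← Complex.normSq_eq_norm_sq, Complex.normSq_apply]
  simp

theorem hsNormSq_nonneg {d : ℕ} (A : Matrix (Fin d) (Fin d) ℂ) : 0 ≤ hsNormSq A := by
  rw [hsNormSq_eq_sum]; positivity

theorem norm_le_hsNorm {d : ℕ} (A : Matrix (Fin d) (Fin d) ℂ) : ‖A‖ ≤ hsNorm A := by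
  have h0 : 0 ≤ hsNorm A := Real.sqrt_nonneg _
  rw [Matrix.norm_le_iff h0]
  intro i j
  apply Real.le_sqrt_of_sq_le
  change _ ≤ hsNormSq A
  rw [hsNormSq_eq_sum]
  calc ‖A i j‖ ^ 2 ≤ ∑ j, ‖A i j‖ ^ 2 :=
        Finset.single_le_sum (f := fun j => ‖A i j‖ ^ 2) (fun _ _ => by positivity)
          (Finset.mem_univ j)
    _ ≤ _ := Finset.single_le_sum (f := fun i => ∑ j, ‖A i j‖ ^ 2) (fun _ _ => by positivity)
          (Finset.mem_univ i)

theorem hsNorm_le_norm {d : ℕ} (A : Matrix (Fin d) (Fin d) ℂ) : hsNorm A ≤ d * ‖A‖ := by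
  unfold hsNorm
  rw [Real.sqrt_le_left (by positivity)]
  change hsNormSq A ≤ _
  rw [hsNormSq_eq_sum]
  calc ∑ i, ∑ j, ‖A i j‖ ^ 2 ≤ ∑ i : Fin d, ∑ j : Fin d, ‖A‖ ^ 2 := by
        gcongr with i _ j _
        exact Matrix.norm_entry_le_entrywise_sup_norm A
    _ = _ := by simp; ring

theorem hsNorm_smul {d : ℕ} (c : ℝ) (hc : 0 ≤ c) (A : Matrix (Fin d) (Fin d) ℂ) :
    hsNorm ((c : ℂ) • A) = c * hsNorm A := by
  have h : hsNormSq ((c : ℂ) • A) = c ^ 2 * hsNormSq A := by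
    rw [hsNormSq_eq_sum, hsNormSq_eq_sum, Finset.mul_sum]
    refine Finset.sum_congr rfl fun i _ => ?_
    rw [Finset.mul_sum]
    refine Finset.sum_congr rfl fun j _ => ?_
    simp [mul_pow]
  change Real.sqrt (hsNormSq _) = c * Real.sqrt (hsNormSq _)
  rw [h, Real.sqrt_mul (by positivity), Real.sqrt_sq hc]

theorem lin_bound {E F : Type*} [NormedAddCommGroup E] [NormedSpace ℂ E] [NormedAddCommGroup F]
    [NormedSpace ℂ F] [FiniteDimensional ℂ E] (f : E →ₗ[ℂ] F) :
    ∃ C : ℝ, 0 ≤ C ∧ ∀ x, ‖f x‖ ≤ C * ‖x‖ :=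
  ⟨‖f.toContinuousLinearMap‖, norm_nonneg _, f.toContinuousLinearMap.le_opNorm⟩

theorem opNorm2_bound {d : ℕ}
    (Φ : Matrix (Fin d) (Fin d) ℂ →ₗ[ℂ] Matrix (Fin d) (Fin d) ℂ) (A : Matrix (Fin d) (Fin d) ℂ) :
    ‖Φ A‖ ≤ opNorm2 Φ * d * ‖A‖ := by
  have hb : BddAbove {r : ℝ | ∃ A, hsNorm A = 1 ∧ r = hsNorm (Φ A)} := by
    obtain ⟨C, hC, hΦ⟩ := lin_bound Φ
    refine ⟨d * C, ?_⟩
    rintro r ⟨B, hB, rfl⟩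
    refine (hsNorm_le_norm _).trans ?_
    have h1 := hΦ B
    have h2 := norm_le_hsNorm B
    rw [hB] at h2
    have h3 : ‖Φ B‖ ≤ C := by
      refine h1.trans ?_
      exact mul_le_of_le_one_right hC h2
    gcongr
  have key : ‖Φ A‖ ≤ opNorm2 Φ * hsNorm A := by
    by_cases h0 : hsNorm A = 0
    · have h2 := norm_le_hsNorm A
      rw [h0] at h2
      have : A = 0 := norm_le_zero_iff.1 h2
      simp [this, hsNorm]
    · have hpos : 0 < hsNorm A := lt_of_le_of_ne (Real.sqrt_nonneg _) (Ne.symm h0)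
      have h1 : hsNorm (Φ ((((hsNorm A)⁻¹ : ℝ) : ℂ) • A)) ≤ opNorm2 Φ := by
        refine le_csSup hb ⟨_, ?_, rfl⟩
        rw [hsNorm_smul _ (by positivity)]
        exact inv_mul_cancel₀ h0
      rw [map_smul, hsNorm_smul _ (by positivity), inv_mul_le_iff₀ hpos] at h1
      rw [mul_comm]
      exact (norm_le_hsNorm _).trans h1
  have h0 : 0 ≤ opNorm2 Φ := by
    apply Real.sSup_nonneg
    rintro r ⟨B, hB, rfl⟩
    exact Real.sqrt_nonneg _
  calc _ ≤ _ := key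
    _ ≤ opNorm2 Φ * (d * ‖A‖) := by gcongr; exact hsNorm_le_norm A
    _ = _ := by ring

/-- matrix multiplication as a continuous bilinear map -/
noncomputable def mulCLM (d : ℕ) : Matrix (Fin d) (Fin d) ℂ →L[ℝ]
    Matrix (Fin d) (Fin d) ℂ →L[ℝ] Matrix (Fin d) (Fin d) ℂ :=
  (LinearMap.mul ℝ (Matrix (Fin d) (Fin d) ℂ)).toContinuousBilinearMap

theorem hasDerivAt_matmul {d : ℕ} {A B : ℝ → Matrix (Fin d) (Fin d) ℂ}
    {A' B' : Matrix (Fin d) (Fin d) ℂ} {t : ℝ} (hA : HasDerivAt A A' t) (hB : HasDerivAt B B' t) :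
    HasDerivAt (fun t => A t * B t) (A' * B t + A t * B') t := by
  have h := (mulCLM d).hasDerivAt_of_bilinear (u := A) (v := B) (x := t) (fun _ => hA) (fun _ => hB)
  rw [add_comm]
  exact h

theorem contDiffOn_matmul {d : ℕ} {A B : ℝ → Matrix (Fin d) (Fin d) ℂ} {s : Set ℝ} {n : WithTop ℕ∞}
    (hA : ContDiffOn ℝ n A s) (hB : ContDiffOn ℝ n B s) :
    ContDiffOn ℝ n (fun t => A t * B t) s :=
  ((mulCLM d).isBoundedBilinearMap.contDiff (n := n)).comp_contDiffOn (hA.prodMk hB)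

theorem contDiffOn_adPow {d : ℕ} {H A : ℝ → Matrix (Fin d) (Fin d) ℂ} {s : Set ℝ} (hs : IsOpen s)
    (hH : ContDiffOn ℝ (⊤ : ℕ∞) H s) (hA : ContDiffOn ℝ (⊤ : ℕ∞) A s) (n : ℕ) :
    ContDiffOn ℝ (⊤ : ℕ∞) (adPow H n A) s := by
  induction n with
  | zero => exact hA
  | succ n ih =>
    change ContDiffOn ℝ (⊤ : ℕ∞) (fun t => Complex.I • (H t * adPow H n A t - adPow H n A t * H t)
      + deriv (adPow H n A) t) s
    refine ContDiffOn.add ?_ ((contDiffOn_infty_iff_deriv_of_isOpen hs).1 ih).2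
    exact ((contDiffOn_matmul hH ih).sub (contDiffOn_matmul ih hH)).const_smul Complex.I

/-- gksl as a linear map -/
noncomputable def gkslLin {d M : ℕ} (H : ℝ → Matrix (Fin d) (Fin d) ℂ)
    (L : Fin M → ℝ → Matrix (Fin d) (Fin d) ℂ) (t : ℝ) :
    Matrix (Fin d) (Fin d) ℂ →ₗ[ℂ] Matrix (Fin d) (Fin d) ℂ where
  toFun := gksl H L t
  map_add' A B := by
    unfold gksl
    rw [add_add_add_comm, ← smul_add, ← Finset.sum_add_distrib]
    congr 1
    · congr 1; noncomm_ring
    · refine Finset.sum_congr rfl fun m _ => ?_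
      rw [sub_add_sub_comm, ← smul_add]
      congr 1
      · noncomm_ring
      · congr 1; noncomm_ring
  map_smul' c A := by
    unfold gksl
    simp only [Matrix.mul_smul, Matrix.smul_mul, RingHom.id_apply, smul_add, smul_sub,
      Finset.smul_sum, smul_comm c]

theorem gksl_one {d M : ℕ} (H : ℝ → Matrix (Fin d) (Fin d) ℂ)
    (L : Fin M → ℝ → Matrix (Fin d) (Fin d) ℂ) (t : ℝ) : gksl H L t 1 = 0 := by
  unfold gksl
  simp only [mul_one, one_mul, sub_self, smul_zero, zero_add]
  refine Finset.sum_eq_zero fun m _ => ?_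
  rw [← two_smul ℂ (L m t ^ 2), smul_smul]
  simp [pow_two]

theorem trace_gksl {d M : ℕ} (H : ℝ → Matrix (Fin d) (Fin d) ℂ)
    (L : Fin M → ℝ → Matrix (Fin d) (Fin d) ℂ) (t : ℝ) (A : Matrix (Fin d) (Fin d) ℂ) :
    Matrix.trace (gksl H L t A) = 0 := by
  unfold gksl
  simp only [Matrix.trace_add, Matrix.trace_smul, Matrix.trace_sub, Matrix.trace_sum]
  rw [Matrix.trace_mul_comm (H t) A, sub_self, smul_zero, zero_add]
  refine Finset.sum_eq_zero fun m _ => ?_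
  rw [Matrix.trace_mul_comm (L m t ^ 2) A, Matrix.trace_mul_comm (L m t * A), ← mul_assoc, ← pow_two,
    Matrix.trace_mul_comm (L m t ^ 2) A]
  simp only [smul_eq_mul]; ring

theorem energy_term {d : ℕ} (K A : Matrix (Fin d) (Fin d) ℂ) (hK : K.IsHermitian) :
    2 * Matrix.trace (Aᴴ * (K * A * K - (2⁻¹ : ℂ) • (K ^ 2 * A + A * K ^ 2))) =
    - Matrix.trace ((K * A - A * K)ᴴ * (K * A - A * K)) := by
  have hK' : Kᴴ = K := hK
  simp only [Matrix.conjTranspose_sub, Matrix.conjTranspose_mul, hK', mul_sub, sub_mul,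
    Matrix.trace_sub, mul_add, Matrix.mul_smul, Matrix.trace_smul, Matrix.trace_add, smul_eq_mul]
  have e1 : Matrix.trace (Aᴴ * K * (K * A)) = Matrix.trace (Aᴴ * (K ^ 2 * A)) := by
    simp only [pow_two, mul_assoc]
  have e2 : Matrix.trace (K * Aᴴ * (K * A)) = Matrix.trace (Aᴴ * (K * A * K)) := by
    rw [mul_assoc, Matrix.trace_mul_comm]; simp only [mul_assoc]
  have e3 : Matrix.trace (Aᴴ * K * (A * K)) = Matrix.trace (Aᴴ * (K * A * K)) := by
    simp only [mul_assoc]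
  have e4 : Matrix.trace (K * Aᴴ * (A * K)) = Matrix.trace (Aᴴ * (A * K ^ 2)) := by
    rw [mul_assoc, Matrix.trace_mul_comm]; simp only [mul_assoc, pow_two]
  rw [e1, e2, e3, e4]; ring

theorem energy {d M : ℕ} (H : ℝ → Matrix (Fin d) (Fin d) ℂ)
    (L : Fin M → ℝ → Matrix (Fin d) (Fin d) ℂ) (t : ℝ) (hH : (H t).IsHermitian)
    (hL : ∀ m, (L m t).IsHermitian) (A : Matrix (Fin d) (Fin d) ℂ) :
    2 * (Matrix.trace (Aᴴ * gksl H L t A)).re = - ∑ m, hsNormSq (L m t * A - A * L m t) := by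
  unfold gksl
  rw [mul_add, Matrix.trace_add, Complex.add_re, mul_add, Finset.mul_sum, Matrix.trace_sum,
    Complex.re_sum, Finset.mul_sum, ← Finset.sum_neg_distrib]
  have hH' : (H t)ᴴ = H t := hH
  have h1 : (Matrix.trace (Aᴴ * ((-Complex.I) • (H t * A - A * H t)))).re = 0 := by
    have r1 : (Matrix.trace (Aᴴ * (H t * A))).im = 0 := by
      rw [← Complex.conj_eq_iff_im]
      change star _ = _
      rw [← Matrix.trace_conjTranspose]
      simp only [Matrix.conjTranspose_mul, Matrix.conjTranspose_conjTranspose, hH', mul_assoc]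
    have r2 : (Matrix.trace (Aᴴ * (A * H t))).im = 0 := by
      rw [← Complex.conj_eq_iff_im]
      change star _ = _
      rw [← Matrix.trace_conjTranspose]
      simp only [Matrix.conjTranspose_mul, Matrix.conjTranspose_conjTranspose, hH', mul_assoc]
      rw [Matrix.trace_mul_comm]; simp only [mul_assoc]
    rw [Matrix.mul_smul, Matrix.trace_smul, mul_sub, Matrix.trace_sub]
    simp [r1, r2]
  rw [h1, mul_zero, zero_add]
  refine Finset.sum_congr rfl fun m _ => ?_
  have := congrArg Complex.re (energy_term (L m t) A (hL m))
  rw [Complex.neg_re] at this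
  unfold hsNormSq
  rw [← this]
  simp

theorem continuous_hsNormSq {d : ℕ} :
    Continuous (hsNormSq : Matrix (Fin d) (Fin d) ℂ → ℝ) := by
  unfold hsNormSq; fun_prop

theorem hasDerivAt_hsNormSq {d M : ℕ} (H : ℝ → Matrix (Fin d) (Fin d) ℂ)
    (L : Fin M → ℝ → Matrix (Fin d) (Fin d) ℂ) (t : ℝ) (hH : (H t).IsHermitian)
    (hL : ∀ m, (L m t).IsHermitian) (σ : ℝ → Matrix (Fin d) (Fin d) ℂ)
    (hσ : HasDerivAt σ (gksl H L t (σ t)) t) :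
    HasDerivAt (fun t => hsNormSq (σ t)) (- ∑ m, hsNormSq (L m t * σ t - σ t * L m t)) t := by
  rw [← energy H L t hH hL]
  let S : Matrix (Fin d) (Fin d) ℂ →ₗ[ℝ] Matrix (Fin d) (Fin d) ℂ :=
    { toFun := fun A => Aᴴ
      map_add' := fun A B => Matrix.conjTranspose_add A B
      map_smul' := fun c A => by simp }
  let T : Matrix (Fin d) (Fin d) ℂ →ₗ[ℝ] ℝ :=
    { toFun := fun A => (Matrix.trace A).re
      map_add' := fun A B => by simp
      map_smul' := fun c A => by simp }
  have h1 : HasDerivAt (fun t => (σ t)ᴴ) (gksl H L t (σ t))ᴴ t :=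
    S.toContinuousLinearMap.hasFDerivAt.comp_hasDerivAt t hσ
  have h2 : HasDerivAt (fun t => hsNormSq (σ t)) (Matrix.trace
      ((gksl H L t (σ t))ᴴ * σ t + (σ t)ᴴ * gksl H L t (σ t))).re t :=
    T.toContinuousLinearMap.hasFDerivAt.comp_hasDerivAt t (hasDerivAt_matmul h1 hσ)
  convert h2 using 1
  rw [Matrix.trace_add, Complex.add_re, two_mul]
  congr 1
  have : (gksl H L t (σ t))ᴴ * σ t = ((σ t)ᴴ * gksl H L t (σ t))ᴴ := by simp
  rw [this, Matrix.trace_conjTranspose]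
  simp

theorem ode_exist {E : Type*} [NormedAddCommGroup E] [NormedSpace ℝ E] [CompleteSpace E]
    (f : ℝ → E → E) (t0 δ : ℝ) (K : NNReal) (hδ : 0 ≤ δ) (hδK : δ * K ≤ 1 / 2)
    (hf : ∀ t ∈ Set.Icc t0 (t0 + δ), LipschitzWith K (f t))
    (hf0 : ∀ t ∈ Set.Icc t0 (t0 + δ), f t 0 = 0)
    (hc : ∀ x, ContinuousOn (fun t => f t x) (Set.Icc t0 (t0 + δ))) (X : E) :
    ∃ α : ℝ → E, α t0 = X ∧ ∀ t ∈ Set.Icc t0 (t0 + δ),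
      HasDerivWithinAt α (f t (α t)) (Set.Icc t0 (t0 + δ)) t := by
  have hp : IsPicardLindelof f (tmin := t0) (tmax := t0 + δ) ⟨t0, by simp [hδ]⟩ X
      (‖X‖₊ + 1) 0 (K * (2 * (‖X‖₊ + 1))) K := by
    refine ⟨fun t ht => (hf t ht).lipschitzOnWith, fun x _ => hc x, fun t ht x hx => ?_, ?_⟩
    · have h1 := (hf t ht).dist_le_mul x 0
      rw [hf0 t ht, dist_zero_right, dist_zero_right] at h1
      refine h1.trans ?_
      push_cast
      have h2 : ‖x‖ ≤ 2 * (‖X‖ + 1) := by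
        have h3 : ‖x - X‖ ≤ ‖X‖ + 1 := by simpa [dist_eq_norm] using hx
        have h4 := norm_le_norm_sub_add x X
        linarith [norm_nonneg X]
      exact mul_le_mul_of_nonneg_left h2 K.2
    · have : max (t0 + δ - t0) (t0 - t0) = δ := by simp [hδ]
      simp only [this]
      push_cast
      have := norm_nonneg X
      nlinarith
  exact hp.exists_eq_forall_mem_Icc_hasDerivWithinAt₀

theorem ode_conv {E : Type*} [NormedAddCommGroup E] [NormedSpace ℝ E]
    (f : ℝ → E → E) (t0 δ : ℝ) (K : NNReal) (hK : 0 < K)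
    (hf : ∀ t ∈ Set.Icc t0 (t0 + δ), LipschitzWith K (f t))
    (α : ℝ → E) (hα : ∀ t ∈ Set.Icc t0 (t0 + δ),
      HasDerivWithinAt α (f t (α t)) (Set.Icc t0 (t0 + δ)) t)
    (y y' : ℕ → ℝ → E) (hy : ∀ k, ∀ t ∈ Set.Icc t0 (t0 + δ), HasDerivAt (y k) (y' k t) t)
    (ε : ℕ → ℝ) (hε : Tendsto ε atTop (nhds 0))
    (hyε : ∀ k, ∀ t ∈ Set.Icc t0 (t0 + δ), dist (y' k t) (f t (y k t)) ≤ ε k)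
    (h0 : Tendsto (fun k => y k t0) atTop (nhds (α t0))) :
    ∀ t ∈ Set.Icc t0 (t0 + δ), Tendsto (fun k => y k t) atTop (nhds (α t)) := by
  intro t ht
  have hb : ∀ k, dist (y k t) (α t) ≤ gronwallBound (dist (y k t0) (α t0)) K (ε k + 0) (t - t0) := by
    intro k
    refine dist_le_of_approx_trajectories_ODE_of_mem (v := f) (s := fun _ => Set.univ)
      (f' := y' k) (g' := fun t => f t (α t)) (b := t0 + δ)
      (fun t ht => (hf t (Set.Ico_subset_Icc_self ht)).lipschitzOnWith)
      (fun t ht => (hy k t ht).continuousAt.continuousWithinAt)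
      (fun t ht => (hy k t (Set.Ico_subset_Icc_self ht)).hasDerivWithinAt)
      (fun t ht => hyε k t (Set.Ico_subset_Icc_self ht)) (fun _ _ => trivial)
      (fun t ht => (hα t ht).continuousWithinAt)
      (fun t ht => ?_) (fun t _ => by simp) (fun _ _ => trivial) le_rfl t ht
    exact (hα t (Set.Ico_subset_Icc_self ht)).mono_of_mem_nhdsWithin (Icc_mem_nhdsGE_of_mem ht)
  rw [tendsto_iff_dist_tendsto_zero]
  refine squeeze_zero (fun _ => dist_nonneg) hb ?_
  have hK' : (K : ℝ) ≠ 0 := by exact_mod_cast hK.ne'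
  simp only [gronwallBound_of_K_ne_0 hK', add_zero]
  rw [tendsto_iff_dist_tendsto_zero] at h0
  have := (h0.mul_const (Real.exp (K * (t - t0)))).add
    ((hε.div_const (K : ℝ)).mul_const (Real.exp (K * (t - t0)) - 1))
  simpa using this

theorem comm_adPow {d : ℕ} {H A x : ℝ → Matrix (Fin d) (Fin d) ℂ} {s u : Set ℝ} (hs : IsOpen s)
    (hu : IsOpen u) (hus : u ⊆ s)
    (hH : ContDiffOn ℝ (⊤ : ℕ∞) H s) (hA : ContDiffOn ℝ (⊤ : ℕ∞) A s)
    (hx : ∀ t ∈ u, HasDerivAt x ((-Complex.I) • (H t * x t - x t * H t)) t)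
    (h0 : ∀ t ∈ u, A t * x t - x t * A t = 0) (n : ℕ) :
    ∀ t ∈ u, adPow H n A t * x t - x t * adPow H n A t = 0 := by
  induction n with
  | zero => exact h0
  | succ n ih =>
    intro t ht
    have hB : HasDerivAt (adPow H n A) (deriv (adPow H n A) t) t :=
      (((contDiffOn_adPow hs hH hA n).contDiffAt (hs.mem_nhds (hus ht))).differentiableAt
        (by simp)).hasDerivAt
    have h1 := (hasDerivAt_matmul hB (hx t ht)).sub (hasDerivAt_matmul (hx t ht) hB)
    have h2 : HasDerivAt (fun t => adPow H n A t * x t - x t * adPow H n A t) 0 t := by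
      refine (hasDerivAt_const t (0 : Matrix (Fin d) (Fin d) ℂ)).congr_of_eventuallyEq ?_
      filter_upwards [hu.mem_nhds ht] with r hr using ih r hr
    have h3 := h1.unique h2
    have h4 := ih t ht
    change (Complex.I • (H t * adPow H n A t - adPow H n A t * H t) + deriv (adPow H n A) t) * x t
      - x t * (Complex.I • (H t * adPow H n A t - adPow H n A t * H t) + deriv (adPow H n A) t) = 0
    set B := adPow H n A t
    set B' := deriv (adPow H n A) t
    set h := H t
    set X := x t
    have h5 : B' * X - X * B' = Complex.I • (B * (h * X - X * h) - (h * X - X * h) * B) := by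
      rw [← sub_eq_zero, ← h3]
      simp only [Matrix.mul_smul, Matrix.smul_mul]
      simp only [neg_smul]
      rw [smul_sub]
      abel
    have h6 : (Complex.I • (h * B - B * h) + B') * X - X * (Complex.I • (h * B - B * h) + B')
        = Complex.I • ((h * B - B * h) * X - X * (h * B - B * h)) + (B' * X - X * B') := by
      simp only [Matrix.mul_smul, Matrix.smul_mul, add_mul, mul_add]
      rw [smul_sub]
      abel
    rw [h6, h5, ← smul_add]
    have h7 : (h * B - B * h) * X - X * (h * B - B * h) +
        (B * (h * X - X * h) - (h * X - X * h) * B) = h * (B * X - X * B) - (B * X - X * B) * h := by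
      noncomm_ring
    rw [h7, h4]; simp

theorem comm_top {d : ℕ} (hd : 0 < d) (S : Set (Matrix (Fin d) (Fin d) ℂ))
    (hS : Algebra.adjoin ℂ S = ⊤)
    (X : Matrix (Fin d) (Fin d) ℂ) (hX : ∀ A ∈ S, A * X - X * A = 0) (htr : Matrix.trace X = 0) :
    X = 0 := by
  have h1 : Algebra.adjoin ℂ S ≤ Subalgebra.centralizer ℂ {X} := by
    refine Algebra.adjoin_le fun A hA => ?_
    rw [SetLike.mem_coe, Subalgebra.mem_centralizer_iff]
    rintro g rfl
    exact (sub_eq_zero.1 (hX A hA)).symm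
  rw [hS] at h1
  have h2 : X ∈ Subalgebra.center ℂ (Matrix (Fin d) (Fin d) ℂ) := by
    rw [Subalgebra.mem_center_iff]
    intro b
    have := h1 (Algebra.mem_top (x := b))
    rw [Subalgebra.mem_centralizer_iff] at this
    exact (this X rfl).symm
  rw [Algebra.IsCentral.center_eq_bot, Algebra.mem_bot] at h2
  obtain ⟨c, rfl⟩ := h2
  rw [Algebra.algebraMap_eq_smul_one] at htr ⊢
  rw [Matrix.trace_smul, Matrix.trace_one, Fintype.card_fin, smul_eq_mul, mul_eq_zero] at htr
  rcases htr with h | h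
  · simp [h]
  · exact absurd (by exact_mod_cast h) hd.ne'

theorem gksl_sub {d M : ℕ} (H : ℝ → Matrix (Fin d) (Fin d) ℂ)
    (L : Fin M → ℝ → Matrix (Fin d) (Fin d) ℂ) (t : ℝ) (A B : Matrix (Fin d) (Fin d) ℂ) :
    gksl H L t (A - B) = gksl H L t A - gksl H L t B := (gkslLin H L t).map_sub A B

theorem traceless_tendsto {d M : ℕ} (hd : 0 < d)
    (H : ℝ → Matrix (Fin d) (Fin d) ℂ)
    (L : Fin M → ℝ → Matrix (Fin d) (Fin d) ℂ)
    (hH : ∀ t : ℝ, 0 ≤ t → (H t).IsHermitian)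
    (hL : ∀ m, ∀ t : ℝ, 0 ≤ t → (L m t).IsHermitian)
    (hQ : CondQ (gksl H L))
    (t0 : ℝ) (ht0 : 0 ≤ t0)
    (hsmooth : ∃ s : Set ℝ, IsOpen s ∧ t0 ∈ s ∧
      ContDiffOn ℝ (⊤ : ℕ∞) H s ∧ ∀ m, ContDiffOn ℝ (⊤ : ℕ∞) (L m) s)
    (halg : Algebra.adjoin ℂ
        {A : Matrix (Fin d) (Fin d) ℂ | ∃ m n, A = adPow H n (L m) t0} = ⊤)
    (σ : ℝ → Matrix (Fin d) (Fin d) ℂ) (hσ : ∀ t, 0 ≤ t → HasDerivAt σ (gksl H L t (σ t)) t)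
    (htr : ∀ t, 0 ≤ t → Matrix.trace (σ t) = 0) : Tendsto σ atTop (nhds 0) := by
  obtain ⟨s, hs, hts, hHs, hLs⟩ := hsmooth
  obtain ⟨-, ⟨N, hN, hNb⟩, hrec⟩ := hQ
  have hVd : ∀ t, 0 ≤ t → HasDerivAt (fun t => hsNormSq (σ t))
      (- ∑ m, hsNormSq (L m t * σ t - σ t * L m t)) t := fun t ht =>
    hasDerivAt_hsNormSq H L t (hH t ht) (fun m => hL m t ht) σ (hσ t ht)
  have hanti : AntitoneOn (fun t => hsNormSq (σ t)) (Set.Ici 0) := by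
    refine antitoneOn_of_deriv_nonpos (convex_Ici 0)
      (fun t ht => (hVd t ht).continuousAt.continuousWithinAt)
      (fun t ht => ?_) (fun t ht => ?_)
    · rw [interior_Ici] at ht
      exact (hVd t (le_of_lt ht)).differentiableAt.differentiableWithinAt
    · rw [interior_Ici] at ht
      rw [(hVd t (le_of_lt ht)).deriv, neg_nonpos]
      exact Finset.sum_nonneg fun m _ => hsNormSq_nonneg _
  obtain ⟨v, hv⟩ : ∃ v, Tendsto (fun t => hsNormSq (σ t)) atTop (nhds v) := by
    have h1 : Antitone (fun t => hsNormSq (σ (max t 0))) := fun a b hab =>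
      hanti (Set.mem_Ici.2 (le_max_right _ _)) (Set.mem_Ici.2 (le_max_right _ _)) (max_le_max_right 0 hab)
    refine ⟨_, (tendsto_atTop_ciInf h1 ⟨0, ?_⟩).congr' ?_⟩
    · rintro _ ⟨t, rfl⟩; exact hsNormSq_nonneg _
    · filter_upwards [eventually_ge_atTop 0] with t ht
      simp [max_eq_left ht]
  -- norm bound
  have hbd : ∀ t, 0 ≤ t → ‖σ t‖ ≤ hsNorm (σ 0) := fun t ht =>
    (norm_le_hsNorm _).trans (Real.sqrt_le_sqrt (hanti (Set.mem_Ici.2 le_rfl) ht ht))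
  set C := hsNorm (σ 0) with hC
  have hC0 : 0 ≤ C := Real.sqrt_nonneg _
  have hdpos : (0 : ℝ) < d := by exact_mod_cast hd
  let K : NNReal := ⟨N * d, by positivity⟩
  have hK : 0 < K := by
    change (0 : ℝ) < N * d
    positivity
  have hlip : ∀ t, 0 ≤ t → LipschitzWith K (gksl H L t) := by
    intro t ht
    refine LipschitzWith.of_dist_le_mul fun A B => ?_
    rw [dist_eq_norm, dist_eq_norm, ← gksl_sub]
    refine (opNorm2_bound (gkslLin H L t) (A - B)).trans ?_
    change opNorm2 (gksl H L t) * d * _ ≤ N * d * _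
    gcongr
    exact hNb t ht
  have hzero : ∀ t, gksl H L t 0 = 0 := fun t => (gkslLin H L t).map_zero
  -- choice of δ
  obtain ⟨r, hr, hrs⟩ := Metric.isOpen_iff.1 hs t0 hts
  have hKpos : (0 : ℝ) < K := hK
  obtain ⟨δ, hδ, hδr, hδK⟩ : ∃ δ : ℝ, 0 < δ ∧ δ < r ∧ δ * K ≤ 1 / 2 := by
    refine ⟨min (r / 2) (1 / (2 * K)), by positivity,
      (min_le_left _ _).trans_lt (by linarith), ?_⟩
    calc _ ≤ 1 / (2 * K) * (K : ℝ) := by gcongr; exact min_le_right _ _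
      _ = 1 / 2 := by field_simp
  have hIs : Set.Icc t0 (t0 + δ) ⊆ s := by
    intro t ht
    apply hrs
    rw [Metric.mem_ball, Real.dist_eq, abs_lt]
    constructor <;> linarith [ht.1, ht.2]
  have hI0 : ∀ t ∈ Set.Icc t0 (t0 + δ), 0 ≤ t := fun t ht => ht0.trans ht.1
  have hcont : ∀ x, ContinuousOn (fun t => gksl H L t x) (Set.Icc t0 (t0 + δ)) := by
    intro x
    have hx : ContDiffOn ℝ (⊤ : ℕ∞) (fun _ : ℝ => x) s := contDiffOn_const
    have h3 := fun m => contDiffOn_matmul (hLs m) (hLs m)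
    have h : ContDiffOn ℝ (⊤ : ℕ∞) (fun t => gksl H L t x) s := by
      unfold gksl
      simp only [pow_two]
      refine ContDiffOn.add ?_ (ContDiffOn.sum fun m _ => ?_)
      · exact ((contDiffOn_matmul hHs hx).sub (contDiffOn_matmul hx hHs)).const_smul _
      · exact (contDiffOn_matmul (contDiffOn_matmul (hLs m) hx) (hLs m)).sub
          (((contDiffOn_matmul (h3 m) hx).add (contDiffOn_matmul hx (h3 m))).const_smul _)
    exact h.continuousOn.mono hIs
  -- recurrence times
  have hex : ∀ k : ℕ, ∃ T : ℝ, (k : ℝ) ≤ T ∧ ∀ t ∈ Set.Icc (0 : ℝ) δ,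
      opNorm2 (fun A => gksl H L (T + t) A - gksl H L (t0 + t) A) < 1 / ((k : ℝ) + 1) := by
    intro k
    obtain ⟨ts, h1, h2, h3⟩ := hrec (1 / ((k : ℝ) + 1)) (by positivity) δ hδ t0 ht0
    have h4 : ∀ n : ℕ, n * δ ≤ ts n := by
      intro n
      induction n with
      | zero => simpa using h1 0
      | succ n ih => push_cast; linarith [h2 n]
    obtain ⟨n, hn⟩ := exists_nat_ge ((k : ℝ) / δ)
    rw [div_le_iff₀ hδ] at hn
    exact ⟨ts n, hn.trans (h4 n), h3 n⟩
  choose T hTk hTε using hex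
  have hT0 : ∀ k, 0 ≤ T k := fun k => (Nat.cast_nonneg k).trans (hTk k)
  have hTtop : Tendsto T atTop atTop := tendsto_atTop_mono hTk tendsto_natCast_atTop_atTop
  have : ProperSpace (Matrix (Fin d) (Fin d) ℂ) := FiniteDimensional.proper ℂ _
  obtain ⟨X, -, φ, hφ, hX⟩ := tendsto_subseq_of_bounded
    (Metric.isBounded_closedBall (x := (0 : Matrix (Fin d) (Fin d) ℂ)) (r := C))
    (x := fun k => σ (T k)) (fun k => by
      rw [mem_closedBall_zero_iff]; exact hbd _ (hT0 k))
  have : CompleteSpace (Matrix (Fin d) (Fin d) ℂ) := FiniteDimensional.complete ℂ _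
  obtain ⟨α, hα0, hα⟩ := ode_exist (gksl H L) t0 δ K hδ.le hδK (fun t ht => hlip t (hI0 t ht))
    (fun t _ => hzero t) hcont X
  have hTφ : Tendsto (fun k => T (φ k)) atTop atTop := hTtop.comp hφ.tendsto_atTop
  have hconv : ∀ t ∈ Set.Icc t0 (t0 + δ),
      Tendsto (fun k => σ (T (φ k) + (t - t0))) atTop (nhds (α t)) := by
    refine ode_conv (gksl H L) t0 δ K hK (fun t ht => hlip t (hI0 t ht)) α hα
      (fun k t => σ (T (φ k) + (t - t0)))
      (fun k t => gksl H L (T (φ k) + (t - t0)) (σ (T (φ k) + (t - t0))))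
      (fun k t ht => ?_) (fun k => 1 / ((φ k : ℝ) + 1) * d * C) ?_ (fun k t ht => ?_) ?_
    · have h1 : 0 ≤ T (φ k) + (t - t0) := by linarith [hT0 (φ k), ht.1]
      have h2 : HasDerivAt (fun t => T (φ k) + (t - t0)) 1 t :=
        ((hasDerivAt_id t).sub_const t0).const_add _
      have := (hσ _ h1).scomp t h2
      rw [one_smul] at this
      exact this
    · have := (((tendsto_one_div_add_atTop_nhds_zero_nat (𝕜 := ℝ)).comp
        hφ.tendsto_atTop).mul_const (d : ℝ)).mul_const C
      simpa using this
    · have h1 : 0 ≤ T (φ k) + (t - t0) := by linarith [hT0 (φ k), ht.1]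
      have h2 := hTε (φ k) (t - t0) ⟨by linarith [ht.1], by linarith [ht.2]⟩
      rw [add_sub_cancel] at h2
      rw [dist_eq_norm]
      refine (opNorm2_bound (gkslLin H L (T (φ k) + (t - t0)) - gkslLin H L t) _).trans ?_
      have h3 := hbd _ h1
      have h4 : opNorm2 (gkslLin H L (T (φ k) + (t - t0)) - gkslLin H L t : _ →ₗ[ℂ] _)
        ≤ 1 / ((φ k : ℝ) + 1) := h2.le
      gcongr
    · rw [hα0]
      simpa [Function.comp_def] using hX
  have hVα : ∀ t ∈ Set.Icc t0 (t0 + δ), hsNormSq (α t) = v := by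
    intro t ht
    have h1 := (continuous_hsNormSq.tendsto (α t)).comp (hconv t ht)
    have h2 : Tendsto (fun k => T (φ k) + (t - t0)) atTop atTop :=
      tendsto_atTop_add_const_right _ _ hTφ
    exact tendsto_nhds_unique h1 (hv.comp h2)
  have hαd : ∀ t ∈ Set.Ioo t0 (t0 + δ), HasDerivAt α (gksl H L t (α t)) t := fun t ht =>
    (hα t (Set.Ioo_subset_Icc_self ht)).hasDerivAt (Icc_mem_nhds ht.1 ht.2)
  have hcomm : ∀ t ∈ Set.Ioo t0 (t0 + δ), ∀ m, L m t * α t - α t * L m t = 0 := by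
    intro t ht m
    have ht' : 0 ≤ t := hI0 t (Set.Ioo_subset_Icc_self ht)
    have h1 := hasDerivAt_hsNormSq H L t (hH t ht') (fun m => hL m t ht') α (hαd t ht)
    have h2 : HasDerivAt (fun t => hsNormSq (α t)) 0 t := by
      refine (hasDerivAt_const t v).congr_of_eventuallyEq ?_
      filter_upwards [Ioo_mem_nhds ht.1 ht.2] with r hr using hVα r (Set.Ioo_subset_Icc_self hr)
    have h3 := h1.unique h2
    rw [neg_eq_zero, Finset.sum_eq_zero_iff_of_nonneg (fun m _ => hsNormSq_nonneg _)] at h3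
    have h4 := h3 m (Finset.mem_univ m)
    have h5 := norm_le_hsNorm (L m t * α t - α t * L m t)
    rw [show hsNorm (L m t * α t - α t * L m t) = 0 by
      change Real.sqrt (hsNormSq _) = 0
      rw [h4, Real.sqrt_zero]] at h5
    exact norm_le_zero_iff.1 h5
  have hαd' : ∀ t ∈ Set.Ioo t0 (t0 + δ),
      HasDerivAt α ((-Complex.I) • (H t * α t - α t * H t)) t := by
    intro t ht
    convert hαd t ht using 1
    unfold gksl
    rw [left_eq_add]
    refine Finset.sum_eq_zero fun m _ => ?_
    have h1 : L m t * α t = α t * L m t := sub_eq_zero.1 (hcomm t ht m)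
    have h2 : L m t ^ 2 * α t = α t * L m t ^ 2 := by
      rw [pow_two, mul_assoc, h1, ← mul_assoc, h1, mul_assoc]
    rw [h2, ← two_smul ℂ (α t * L m t ^ 2), smul_smul, h1]
    simp [pow_two, mul_assoc]
  have hX0 : X = 0 := by
    refine comm_top hd _ halg X ?_ ?_
    · rintro _ ⟨m, n, rfl⟩
      have h1 := comm_adPow hs isOpen_Ioo (Set.Ioo_subset_Icc_self.trans hIs) hHs (hLs m) hαd'
        (fun t ht => hcomm t ht m) n
      have h2 : ContinuousWithinAt (adPow H n (L m)) (Set.Ioo t0 (t0 + δ)) t0 :=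
        ((contDiffOn_adPow hs hHs (hLs m) n).continuousOn.continuousAt
          (hs.mem_nhds hts)).continuousWithinAt
      have h3 : ContinuousWithinAt α (Set.Ioo t0 (t0 + δ)) t0 :=
        (hα t0 ⟨le_rfl, by linarith⟩).continuousWithinAt.mono Set.Ioo_subset_Icc_self
      have h4 : Tendsto (fun t => adPow H n (L m) t * α t - α t * adPow H n (L m) t)
        (nhdsWithin t0 (Set.Ioo t0 (t0 + δ)))
        (nhds (adPow H n (L m) t0 * α t0 - α t0 * adPow H n (L m) t0)) :=
        (h2.mul h3).sub (h3.mul h2)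
      have h5 : Tendsto (fun t => adPow H n (L m) t * α t - α t * adPow H n (L m) t)
        (nhdsWithin t0 (Set.Ioo t0 (t0 + δ))) (nhds 0) := by
        refine tendsto_const_nhds.congr' ?_
        filter_upwards [self_mem_nhdsWithin] with t ht using (h1 t ht).symm
      have : (nhdsWithin t0 (Set.Ioo t0 (t0 + δ))).NeBot :=
        left_nhdsWithin_Ioo_neBot (by linarith)
      rw [hα0] at h4
      exact tendsto_nhds_unique h4 h5
    · have h1 : Continuous (fun A : Matrix (Fin d) (Fin d) ℂ => Matrix.trace A) := by fun_prop
      have h2 := (h1.tendsto X).comp hX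
      refine tendsto_nhds_unique h2 (tendsto_const_nhds.congr fun k => ?_)
      exact (htr _ (hT0 (φ k))).symm
  have hv0 : v = 0 := by
    rw [← hVα t0 ⟨le_rfl, by linarith⟩, hα0, hX0]
    simp [hsNormSq]
  refine tendsto_zero_iff_norm_tendsto_zero.2 ?_
  refine squeeze_zero (fun _ => norm_nonneg _) (fun t => norm_le_hsNorm (σ t)) ?_
  have := hv.sqrt
  rw [hv0, Real.sqrt_zero] at this
  exact this

/-- algebraic sufficient condition for the uniqueness of the steady state. -/
theorem stmt1 {d M : ℕ} (hd : 0 < d)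
    (H : ℝ → Matrix (Fin d) (Fin d) ℂ)
    (L : Fin M → ℝ → Matrix (Fin d) (Fin d) ℂ)
    (hH : ∀ t : ℝ, 0 ≤ t → (H t).IsHermitian)
    (hL : ∀ m, ∀ t : ℝ, 0 ≤ t → (L m t).IsHermitian)
    (hQ : CondQ (gksl H L))
    (t0 : ℝ) (ht0 : 0 ≤ t0)
    (hsmooth : ∃ s : Set ℝ, IsOpen s ∧ t0 ∈ s ∧
      ContDiffOn ℝ (⊤ : ℕ∞) H s ∧ ∀ m, ContDiffOn ℝ (⊤ : ℕ∞) (L m) s)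
    (halg : Algebra.adjoin ℂ
        {A : Matrix (Fin d) (Fin d) ℂ | ∃ m n, A = adPow H n (L m) t0} = ⊤) :
    ∀ ρ0 : Matrix (Fin d) (Fin d) ℂ, IsDensity ρ0 →
      ∀ ρ : ℝ → Matrix (Fin d) (Fin d) ℂ, ρ 0 = ρ0 →
        (∀ t : ℝ, 0 ≤ t → HasDerivAt ρ (gksl H L t (ρ t)) t) →
        Tendsto ρ atTop (nhds (((d : ℂ))⁻¹ • (1 : Matrix (Fin d) (Fin d) ℂ))) := by
  intro ρ0 hρ0 ρ hρ hsol
  set c : Matrix (Fin d) (Fin d) ℂ := ((d : ℂ))⁻¹ • (1 : Matrix (Fin d) (Fin d) ℂ) with hc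
  have hgc : ∀ t, gksl H L t c = 0 := by
    intro t
    change gkslLin H L t c = 0
    rw [hc, map_smul]
    change _ • gksl H L t 1 = 0
    rw [gksl_one, smul_zero]
  have hdc : (d : ℂ) ≠ 0 := by exact_mod_cast hd.ne'
  have htrρ : ∀ t, 0 ≤ t → Matrix.trace (ρ t) = 1 := by
    intro t ht
    let T : Matrix (Fin d) (Fin d) ℂ →ₗ[ℝ] ℂ :=
      { toFun := fun A => Matrix.trace A
        map_add' := fun A B => by simp
        map_smul' := fun c A => by simp }
    have h1 : ∀ r, 0 ≤ r → HasDerivAt (fun r => Matrix.trace (ρ r)) 0 r := by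
      intro r hr
      have : HasDerivAt (fun r => Matrix.trace (ρ r)) (Matrix.trace (gksl H L r (ρ r))) r :=
        T.toContinuousLinearMap.hasFDerivAt.comp_hasDerivAt r (hsol r hr)
      rwa [trace_gksl] at this
    have h2 := constant_of_has_deriv_right_zero (f := fun r => Matrix.trace (ρ r)) (a := 0) (b := t)
      (fun r hr => (h1 r hr.1).continuousAt.continuousWithinAt)
      (fun r hr => (h1 r hr.1).hasDerivWithinAt) t ⟨ht, le_rfl⟩
    rw [h2, hρ, hρ0.2]
  have key := traceless_tendsto hd H L hH hL hQ t0 ht0 hsmooth halg (fun t => ρ t - c)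
    (fun t ht => by
      rw [gksl_sub, hgc, sub_zero]
      exact (hsol t ht).sub_const c)
    (fun t ht => by
      rw [Matrix.trace_sub, htrρ t ht, hc, Matrix.trace_smul, Matrix.trace_one, Fintype.card_fin,
        smul_eq_mul, inv_mul_cancel₀ hdc, sub_self])
  have := key.add_const c
  simpa using this
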